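/- Let n = 2k+1 be odd with n ≠ 1, and let q be a primitive n-th root of unity. Let φ : F₂ → PGL(2,ℂ) be the homomorphism from the free group F₂ on two generators x, y defined by φ(x) = [A(q)] and φ(y) = [B(q)]. Then the kernel of φ is the normal closure in F₂ of the set {x^{2k+1}, y^{2k+1}, (xy)^{2k+1}, (x⁻¹y^k)², (y^k x^{k−1})³}. -/

import Mathlib

open Matrix

/-- The matrix `A(q)` (image of `g₁²` under the reduced Burau representation `β₋q`),
as an element of `GL(2,ℂ)` (junk value `1` if `q = 0`). -/
noncomputable def AGL (q : ℂ) : GL (Fin 2) ℂ :=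
  if h : q = 0 then 1 else
    Matrix.GeneralLinearGroup.mkOfDetNeZero !![q ^ 2, 1 + q; 0, 1]
      (by rw [Matrix.det_fin_two_of]; simpa using pow_ne_zero 2 h)

/-- The matrix `B(q)` (image of `g₂²` under the reduced Burau representation `β₋q`),
as an element of `GL(2,ℂ)` (junk value `1` if `q = 0`). -/
noncomputable def BGL (q : ℂ) : GL (Fin 2) ℂ :=
  if h : q = 0 then 1 else
    Matrix.GeneralLinearGroup.mkOfDetNeZero !![1, 0; -q - q ^ 2, q ^ 2]
      (by rw [Matrix.det_fin_two_of]; simpa using pow_ne_zero 2 h)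

/-- `PGL(2,ℂ)`: the quotient of `GL(2,ℂ)` by its center. -/
abbrev PGL2 : Type := GL (Fin 2) ℂ ⧸ Subgroup.center (GL (Fin 2) ℂ)

/-- The canonical projection `GL(2,ℂ) → PGL(2,ℂ)`. -/
noncomputable def pgl : GL (Fin 2) ℂ →* PGL2 := QuotientGroup.mk' _

/-- The class `[A(q)] ∈ PGL(2,ℂ)`. -/
noncomputable def Apr (q : ℂ) : PGL2 := pgl (AGL q)

/-- The class `[B(q)] ∈ PGL(2,ℂ)`. -/
noncomputable def Bpr (q : ℂ) : PGL2 := pgl (BGL q)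

/-- The group `Γ(q) = Γ₋q ⊆ PGL(2,ℂ)` generated by `[A(q)]` and `[B(q)]`. -/
noncomputable def Gamma (q : ℂ) : Subgroup PGL2 := Subgroup.closure {Apr q, Bpr q}

/-- Relators of the triangle group `Δ(l,m,n) = ⟨x,y | x^l = y^m = (xy)^n = 1⟩`. -/
def triangleRels (l m n : ℕ) : Set (FreeGroup (Fin 2)) :=
  {(FreeGroup.of 0) ^ l, (FreeGroup.of 1) ^ m, (FreeGroup.of 0 * FreeGroup.of 1) ^ n}

/-- The triangle group `Δ(l,m,n)`. -/
abbrev Triangle (l m n : ℕ) := PresentedGroup (triangleRels l m n)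

namespace CoxeterSystem

variable {B W V : Type*} {M : CoxeterMatrix B} [Group W] (cs : CoxeterSystem M W)
  [AddCommGroup V] [Module ℝ V] {ρ : W →* Module.End ℝ V} {e : B → V}

theorem sin_smul_alternatingWord
    (h : ∀ i j, ρ (cs.simple i) (e j) = e j + (2 * Real.cos (Real.pi / M i j)) • e i)
    (i j : B) (m : ℕ) :
    Real.sin (Real.pi / M i j) • ρ (cs.wordProd (alternatingWord i j m)) (e i) =
      if Even m then
        Real.sin ((m + 1) * (Real.pi / M i j)) • e i + Real.sin (m * (Real.pi / M i j)) • e j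
      else
        Real.sin (m * (Real.pi / M i j)) • e i +
          Real.sin ((m + 1) * (Real.pi / M i j)) • e j := by
  have hself : ∀ i, ρ (cs.simple i) (e i) = - e i := by
    intro i
    rw [h]
    simp only [M.diagonal, Nat.cast_one, div_one, Real.cos_pi]
    module
  induction m with
  | zero => simp [alternatingWord]
  | succ m ih =>
    have hsin : Real.sin ((m + 1 + 1 : ℝ) * (Real.pi / M i j)) =
        2 * Real.cos (Real.pi / M i j) * Real.sin ((m + 1 : ℝ) * (Real.pi / M i j)) -
          Real.sin (m * (Real.pi / M i j)) := by
      have e1 : (m + 1 + 1 : ℝ) * (Real.pi / M i j) =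
        (m + 1 : ℝ) * (Real.pi / M i j) + Real.pi / M i j := by ring
      have e2 : (m : ℝ) * (Real.pi / M i j) =
        (m + 1 : ℝ) * (Real.pi / M i j) - Real.pi / M i j := by ring
      rw [e1, e2, Real.sin_add, Real.sin_sub]
      ring
    rw [alternatingWord_succ', wordProd_cons, map_mul, Module.End.mul_apply, ← map_smul, ih]
    by_cases hm : Even m
    · have hm' : ¬ Even (m + 1) := by simpa [Nat.even_add_one] using hm
      simp only [hm, hm', if_true, if_false, map_add, map_smul, hself, h j i,
        M.symmetric j i, Nat.cast_add, Nat.cast_one, hsin]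
      module
    · have hm' : Even (m + 1) := by simpa [Nat.even_add_one] using hm
      simp only [hm, hm', if_true, if_false, map_add, map_smul, hself, h i j,
        Nat.cast_add, Nat.cast_one, hsin]
      module

theorem exists_nonneg_alternatingWord (hM : ∀ i j, M i j ≠ 0)
    (h : ∀ i j, ρ (cs.simple i) (e j) = e j + (2 * Real.cos (Real.pi / M i j)) • e i)
    {i j : B} (hij : i ≠ j) {m : ℕ} (hm : m < M i j) :
    ∃ a b : ℝ, 0 ≤ a ∧ 0 ≤ b ∧
      ρ (cs.wordProd (alternatingWord i j m)) (e i) = a • e i + b • e j := by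
  have hM2 : 2 ≤ M i j := by
    have := hM i j
    have := M.off_diagonal i j hij
    omega
  have hMpos : (0 : ℝ) < M i j := by exact_mod_cast (by omega : 0 < M i j)
  have hnn : ∀ l : ℕ, l ≤ M i j → 0 ≤ Real.sin (l * (Real.pi / M i j)) := by
    intro l hl
    have hl' : (l : ℝ) ≤ M i j := by exact_mod_cast hl
    apply Real.sin_nonneg_of_nonneg_of_le_pi (by positivity)
    calc (l : ℝ) * (Real.pi / M i j) ≤ M i j * (Real.pi / M i j) := by gcongr
      _ = Real.pi := by field_simp
  have hs : 0 < Real.sin (Real.pi / M i j) := by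
    apply Real.sin_pos_of_pos_of_lt_pi (by positivity)
    rw [div_lt_iff₀ hMpos]
    have : (2 : ℝ) ≤ M i j := by exact_mod_cast hM2
    nlinarith [Real.pi_pos]
  have key := sin_smul_alternatingWord cs h i j m
  have h0 := hnn m hm.le
  have h1 := hnn (m + 1) hm
  push_cast at h1
  rw [← eq_inv_smul_iff₀ hs.ne'] at key
  rw [key]
  split_ifs
  · exact ⟨_, _, mul_nonneg (inv_nonneg.2 hs.le) h1, mul_nonneg (inv_nonneg.2 hs.le) h0,
      by rw [smul_add, smul_smul, smul_smul]⟩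
  · exact ⟨_, _, mul_nonneg (inv_nonneg.2 hs.le) h0, mul_nonneg (inv_nonneg.2 hs.le) h1,
      by rw [smul_add, smul_smul, smul_smul]⟩

theorem nonneg_of_length_lt (hM : ∀ i j, M i j ≠ 0)
    (h : ∀ i j, ρ (cs.simple i) (e j) = e j + (2 * Real.cos (Real.pi / M i j)) • e i)
    (f : V →ₗ[ℝ] ℝ) (hf : ∀ i, 0 < f (e i)) (w : W) (i : B)
    (hw : cs.length w < cs.length (w * cs.simple i)) : 0 ≤ f (ρ w (e i)) := by
  classical
  induction hn : cs.length w using Nat.strong_induction_on generalizing w i with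
  | _ n ih =>
  by_cases hw1 : w = 1
  · subst hw1
    simpa using (hf i).le
  obtain ⟨j, hj⟩ := cs.exists_rightDescent_of_ne_one hw1
  have hij : i ≠ j := by
    rintro rfl
    exact absurd hw (not_lt.2 (le_of_lt hj))
  have hj' := cs.isRightDescent_iff.1 hj
  let P : ℕ → Prop := fun N ↦ ∃ m v, w = v * cs.wordProd (alternatingWord i j m) ∧
    cs.length v + m = cs.length w ∧ cs.length v = N
  have hP1 : P (cs.length (w * cs.simple j)) :=
    ⟨1, w * cs.simple j, by simp [alternatingWord], hj', rfl⟩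
  have hex : ∃ N, P N := ⟨_, hP1⟩
  obtain ⟨m, v, hwv, hlen, hN⟩ := Nat.find_spec hex
  have hmin : ∀ N, P N → cs.length v ≤ N := fun N hPN ↦ hN ▸ Nat.find_min' hex hPN
  have hvlt : cs.length v < cs.length w := (hmin _ hP1).trans_lt hj
  have hmpos : m ≠ 0 := by omega
  have hmM : m < M i j := by
    by_contra hcon
    have hred := cs.not_isReduced_alternatingWord j i (hM j i)
      (show m + 1 > M j i by rw [M.symmetric j i]; omega)
    have hle := cs.length_wordProd_le (alternatingWord j i (m + 1))
    have hws : w * cs.simple i = v * cs.wordProd (alternatingWord j i (m + 1)) := by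
      rw [alternatingWord_succ, wordProd_concat, ← mul_assoc, ← hwv]
    have h3 := cs.length_mul_le v (cs.wordProd (alternatingWord j i (m + 1)))
    rw [← hws] at h3
    unfold IsReduced at hred
    rw [length_alternatingWord] at hred hle
    omega
  have hnext : cs.length v < cs.length (v * cs.simple (if Even m then j else i)) := by
    rcases cs.length_mul_simple v (if Even m then j else i) with h4 | h4
    · omega
    · have := hmin (cs.length (v * cs.simple (if Even m then j else i)))
        ⟨m + 1, _, by rw [alternatingWord_succ', wordProd_cons, mul_assoc,
          simple_mul_simple_cancel_left, hwv], by omega, rfl⟩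
      omega
  have hprev : cs.length v < cs.length (v * cs.simple (if Even m then i else j)) := by
    rcases cs.length_mul_simple v (if Even m then i else j) with h4 | h4
    · omega
    · obtain ⟨l, rfl⟩ := Nat.exists_eq_succ_of_ne_zero hmpos
      have hpar : (if Even (l + 1) then i else j) = if Even l then j else i := by
        by_cases hl : Even l <;> simp [hl, Nat.even_add_one]
      simp only [Nat.succ_eq_add_one] at *
      rw [hpar] at h4
      have hw' : w = (v * cs.simple (if Even l then j else i)) *
          cs.wordProd (alternatingWord i j l) := by
        rw [hwv, alternatingWord_succ', wordProd_cons, mul_assoc]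
      have h5 := cs.length_mul_le (v * cs.simple (if Even l then j else i))
        (cs.wordProd (alternatingWord i j l))
      have h6 := cs.length_wordProd_le (alternatingWord i j l)
      rw [← hw'] at h5
      rw [length_alternatingWord] at h6
      omega
  have hboth : cs.length v < cs.length (v * cs.simple i) ∧
      cs.length v < cs.length (v * cs.simple j) := by
    split_ifs at hnext hprev
    · exact ⟨hprev, hnext⟩
    · exact ⟨hnext, hprev⟩
  have hi := ih _ (hn ▸ hvlt) v i hboth.1 rfl
  have hj := ih _ (hn ▸ hvlt) v j hboth.2 rfl
  obtain ⟨a, b, ha, hb, hab⟩ := cs.exists_nonneg_alternatingWord hM h hij hmM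
  rw [hwv, map_mul, Module.End.mul_apply, hab]
  simp only [map_add, map_smul, smul_eq_mul]
  positivity

/-- Tits: a geometric representation whose simple roots lie in an open half-space is faithful. -/
theorem geometric_injective (hM : ∀ i j, M i j ≠ 0)
    (h : ∀ i j, ρ (cs.simple i) (e j) = e j + (2 * Real.cos (Real.pi / M i j)) • e i)
    (f : V →ₗ[ℝ] ℝ) (hf : ∀ i, 0 < f (e i)) : Function.Injective ρ := by
  rw [injective_iff_map_eq_one]
  intro w hw
  by_contra hw1
  obtain ⟨i, hi⟩ := cs.exists_rightDescent_of_ne_one hw1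
  have h1 := cs.nonneg_of_length_lt hM h f hf (w * cs.simple i) i
    (by rw [simple_mul_simple_cancel_right]; exact hi)
  rw [map_mul, hw, one_mul, h] at h1
  simp only [M.diagonal, Nat.cast_one, div_one, Real.cos_pi, map_add, map_smul, smul_eq_mul] at h1
  linarith [hf i]

end CoxeterSystem

/-- The endomorphism `X ↦ e X e` of an algebra, viewed as a real-linear map. -/
noncomputable def sandwich {R : Type*} [Ring R] [Algebra ℝ R] (e : R) : Module.End ℝ R :=
  LinearMap.mulLeft ℝ e * LinearMap.mulRight ℝ e

theorem sandwich_apply {R : Type*} [Ring R] [Algebra ℝ R] (e x : R) :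
    sandwich e x = e * (x * e) := rfl

theorem sandwich_mul_pow_apply {R : Type*} [Ring R] [Algebra ℝ R] (e f x : R) (m : ℕ) :
    ((sandwich e * sandwich f) ^ m) x = (e * f) ^ m * x * (f * e) ^ m := by
  induction m generalizing x with
  | zero => simp
  | succ m ih =>
    rw [pow_succ, Module.End.mul_apply, ih, Module.End.mul_apply, sandwich_apply, sandwich_apply,
      pow_succ (e * f), pow_succ' (f * e)]
    simp only [mul_assoc]

theorem sin_smul_pow_succ {R : Type*} [Ring R] [Algebra ℝ R] {x : R} {θ : ℝ}
    (hx : x * x = (2 * Real.cos θ) • x - 1) (m : ℕ) :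
    Real.sin θ • x ^ (m + 1) = Real.sin ((m + 1) * θ) • x - Real.sin (m * θ) • (1 : R) := by
  induction m with
  | zero => simp
  | succ m ih =>
    have hsin : Real.sin ((m + 1 + 1 : ℝ) * θ) =
        2 * Real.cos θ * Real.sin ((m + 1 : ℝ) * θ) - Real.sin (m * θ) := by
      have e1 : (m + 1 + 1 : ℝ) * θ = (m + 1 : ℝ) * θ + θ := by ring
      have e2 : (m : ℝ) * θ = (m + 1 : ℝ) * θ - θ := by ring
      rw [e1, e2, Real.sin_add, Real.sin_sub]
      ring
    rw [pow_succ, ← smul_mul_assoc, ih, sub_mul, smul_mul_assoc, smul_mul_assoc, hx, one_mul,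
      Nat.cast_add, Nat.cast_one, hsin]
    module

theorem pow_eq_neg_one_of_mul_self {R : Type*} [Ring R] [Algebra ℝ R] {x : R} {m : ℕ} (hm : 2 ≤ m)
    (hx : x * x = (2 * Real.cos (Real.pi / m)) • x - 1) : x ^ m = -1 := by
  obtain ⟨l, rfl⟩ : ∃ l, m = l + 1 := ⟨m - 1, by omega⟩
  have hpos : (0 : ℝ) < (l + 1 : ℕ) := by positivity
  have hs : 0 < Real.sin (Real.pi / (l + 1 : ℕ)) := by
    apply Real.sin_pos_of_pos_of_lt_pi (by positivity)
    rw [div_lt_iff₀ hpos]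
    have : (2 : ℝ) ≤ (l + 1 : ℕ) := by exact_mod_cast hm
    nlinarith [Real.pi_pos]
  have key := sin_smul_pow_succ hx l
  have e1 : ((l : ℝ) + 1) * (Real.pi / (l + 1 : ℕ)) = Real.pi := by
    push_cast at hpos ⊢
    field_simp
  have e2 : (l : ℝ) * (Real.pi / (l + 1 : ℕ)) = Real.pi - Real.pi / (l + 1 : ℕ) := by
    linear_combination e1
  rw [e2, e1, Real.sin_pi, Real.sin_pi_sub, zero_smul, zero_sub, ← smul_neg] at key
  exact smul_right_injective R hs.ne' key

namespace CoxeterMatrix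

variable {B R : Type*} [Ring R] [Algebra ℝ R] {M : CoxeterMatrix B} {E : B → R}

theorem isLiftable_sandwich (hM : ∀ i j, M i j ≠ 0) (hE : ∀ i, E i * E i = -1)
    (hEE : ∀ i j, E i * E j + E j * E i = (2 * Real.cos (Real.pi / M i j)) • (1 : R)) :
    M.IsLiftable fun i ↦ sandwich (E i) := by
  have hpow : ∀ i j, (E i * E j) ^ M i j = -1 := by
    intro i j
    by_cases hij : i = j
    · subst hij
      rw [M.diagonal, pow_one, hE]
    · apply pow_eq_neg_one_of_mul_self
      · have := hM i j
        have := M.off_diagonal i j hij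
        omega
      · have h1 : E i * E j * (E i * E j) = E i * (E i * E j + E j * E i) * E j
          - E i * E i * (E j * E j) := by noncomm_ring
        rw [h1, hEE, hE, hE, mul_smul_comm, smul_mul_assoc, mul_one]
        simp
  intro i j
  ext x
  rw [sandwich_mul_pow_apply, hpow]
  nth_rw 1 [M.symmetric i j]
  rw [hpow]
  simp

theorem sandwich_apply_root (hE : ∀ i, E i * E i = -1)
    (hEE : ∀ i j, E i * E j + E j * E i = (2 * Real.cos (Real.pi / M i j)) • (1 : R)) (i j : B) :
    sandwich (E i) (E j) = E j + (2 * Real.cos (Real.pi / M i j)) • E i := by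
  have h1 : E i * (E j * E i) = E i * (E i * E j + E j * E i) - E i * E i * E j := by
    noncomm_ring
  rw [sandwich_apply, h1, hEE, hE, mul_smul_comm, mul_one]
  simp [add_comm]

end CoxeterMatrix

/-- The relators in `x, y` presenting the image of the free group in `PGL(2,ℂ)`. -/
def burauRels (k : ℕ) : Set (FreeGroup (Fin 2)) :=
  {(FreeGroup.of 0) ^ (2 * k + 1), (FreeGroup.of 1) ^ (2 * k + 1),
   (FreeGroup.of 0 * FreeGroup.of 1) ^ (2 * k + 1),
   ((FreeGroup.of 0)⁻¹ * (FreeGroup.of 1) ^ k) ^ 2,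
   ((FreeGroup.of 1) ^ k * (FreeGroup.of 0) ^ (k - 1)) ^ 3}

section Group

variable {G : Type*} [Group G] {k : ℕ}

theorem forall_burauRels_iff (φ : FreeGroup (Fin 2) →* G) :
    (∀ r ∈ burauRels k, φ r = 1) ↔
      φ (.of 0) ^ (2 * k + 1) = 1 ∧ φ (.of 1) ^ (2 * k + 1) = 1 ∧
      (φ (.of 0) * φ (.of 1)) ^ (2 * k + 1) = 1 ∧ ((φ (.of 0))⁻¹ * φ (.of 1) ^ k) ^ 2 = 1 ∧
      (φ (.of 1) ^ k * φ (.of 0) ^ (k - 1)) ^ 3 = 1 := by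
  simp [burauRels]

theorem conj_eq_of_triangle {a j : G} (hj : j * j = 1) (haj : (a * j) ^ 3 = 1) :
    j * a * j = a⁻¹ * j * a⁻¹ := by
  have hji : j⁻¹ = j := inv_eq_of_mul_eq_one_right hj
  have h1 : a * j * a * (j * a * j) = 1 := by rw [← haj]; simp [pow_succ, mul_assoc]
  have h2 := (inv_eq_of_mul_eq_one_right h1).symm
  rw [h2]
  simp [hji, mul_assoc]

/-- A pair of generators `a, j` of a quotient of the `(2,3,2k+1)` triangle group yields a pair
`a², j a² j` satisfying `burauRels`. -/
theorem burauRels_of_triangle (hk : k ≠ 0) {a j : G} (ha : a ^ (2 * k + 1) = 1) (hj : j * j = 1)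
    (haj : (a * j) ^ 3 = 1) (φ : FreeGroup (Fin 2) →* G) (hφ0 : φ (.of 0) = a ^ 2)
    (hφ1 : φ (.of 1) = j * a ^ 2 * j) : ∀ r ∈ burauRels k, φ r = 1 := by
  have hji : j⁻¹ = j := inv_eq_of_mul_eq_one_right hj
  have hconj : ∀ m : ℕ, (j * a ^ 2 * j) ^ m = j * a ^ (2 * m) * j := by
    intro m
    have := conj_pow (i := m) (a := j) (b := a ^ 2)
    rw [hji] at this
    rw [this, pow_mul]
  have ha2 : a ^ (2 * k) = a⁻¹ := eq_inv_of_mul_eq_one_left (by rw [← pow_succ, ha])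
  have hjaj := conj_eq_of_triangle hj haj
  have hjaj' : j * a⁻¹ * j = a * j * a := by
    have := congrArg (fun g ↦ g⁻¹) hjaj
    simpa [hji, mul_assoc] using this
  have hpow1 : (a ^ 2) ^ (2 * k + 1) = 1 := by rw [← pow_mul, mul_comm, pow_mul, ha, one_pow]
  have hYk : (j * a ^ 2 * j) ^ k = a * j * a := by rw [hconj, ha2, hjaj']
  have hXk : (a ^ 2) ^ (k - 1) = a⁻¹ * a⁻¹ * a⁻¹ := by
    obtain ⟨l, rfl⟩ := Nat.exists_eq_succ_of_ne_zero hk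
    rw [← pow_mul]
    have h1 : a ^ (2 * l) * a ^ 2 = a⁻¹ := by rw [← pow_add, ← ha2]; rfl
    have h2 : a ^ (2 * l) = a⁻¹ * (a ^ 2)⁻¹ := eq_mul_inv_of_mul_eq h1
    simp only [Nat.succ_eq_add_one, Nat.add_sub_cancel, h2]
    group
  rw [forall_burauRels_iff, hφ0, hφ1]
  refine ⟨hpow1, ?_, ?_, ?_, ?_⟩
  · rw [hconj, mul_comm 2, pow_mul, ha, one_pow, mul_one, hj]
  · have h1 : a ^ 2 * (j * a ^ 2 * j) = (a * j) * (a ^ 2)⁻¹ * (a * j)⁻¹ := by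
      have h2 : j * a ^ 2 * j = (j * a * j) * (j * a * j) := by
        calc j * a ^ 2 * j = j * a * 1 * a * j := by simp [pow_two, mul_assoc]
          _ = _ := by rw [← hj]; group
      have h3 : a ^ 2 * (j * a ^ 2 * j) = a * j * a⁻¹ * a⁻¹ * j * a⁻¹ := by
        rw [h2, hjaj]
        group
      rw [h3, _root_.mul_inv_rev, hji]
      group
    rw [h1, conj_pow, inv_pow, hpow1]
    simp
  · rw [hYk]
    calc ((a ^ 2)⁻¹ * (a * j * a)) ^ 2 = a⁻¹ * (j * j) * a := by simp [pow_succ, mul_assoc]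
      _ = 1 := by rw [hj]; group
  · rw [hYk, hXk]
    have h4 : a * j * a * (a⁻¹ * a⁻¹ * a⁻¹) = a * (a * j)⁻¹ * a⁻¹ := by
      rw [_root_.mul_inv_rev, hji]; group
    rw [h4, conj_pow, inv_pow, haj]
    simp

/-- Conversely, `burauRels` yields the relations of the `(2,3,2k+1)` triangle group. -/
theorem triangle_of_burauRels (hk : k ≠ 0) {x y : G} (φ : FreeGroup (Fin 2) →* G)
    (hφ0 : φ (.of 0) = x) (hφ1 : φ (.of 1) = y) (h : ∀ r ∈ burauRels k, φ r = 1) {a b j : G}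
    (hxa : a = x ^ (k + 1)) (hyb : b = y ^ (k + 1)) (hj' : j = a * b * a) :
    a ^ (2 * k + 1) = 1 ∧ j * j = 1 ∧ (a * j) ^ 3 = 1 ∧ x = a ^ 2 ∧ y = j * a ^ 2 * j := by
  rw [forall_burauRels_iff, hφ0, hφ1] at h
  obtain ⟨h1, h2, -, h4, h5⟩ := h
  have hx : x = a ^ 2 := by
    rw [hxa, ← pow_mul, show (k + 1) * 2 = 2 * k + 1 + 1 by ring, pow_succ, h1, one_mul]
  have hy : y = b ^ 2 := by
    rw [hyb, ← pow_mul, show (k + 1) * 2 = 2 * k + 1 + 1 by ring, pow_succ, h2, one_mul]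
  have hyk : y ^ k = b⁻¹ := by
    apply eq_inv_of_mul_eq_one_left
    rw [hyb, ← pow_add, show k + (k + 1) = 2 * k + 1 by ring, h2]
  have hxk : x ^ k = a⁻¹ := by
    apply eq_inv_of_mul_eq_one_left
    rw [hxa, ← pow_add, show k + (k + 1) = 2 * k + 1 by ring, h1]
  have hxk1 : x ^ (k - 1) = a⁻¹ * (a ^ 2)⁻¹ := by
    apply eq_mul_inv_of_mul_eq
    rw [← hx, ← hxk, ← pow_succ, Nat.sub_add_cancel (Nat.one_le_iff_ne_zero.2 hk)]
  have ha : a ^ (2 * k + 1) = 1 := by rw [hxa, ← pow_mul, mul_comm, pow_mul, h1, one_pow]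
  rw [hyk, hx] at h4
  rw [hyk, hxk1] at h5
  have hj : j * j = 1 := by
    have : j * j = a * (((a ^ 2)⁻¹ * b⁻¹) ^ 2)⁻¹ * a⁻¹ := by
      rw [hj']; simp [pow_succ, mul_assoc]
    rw [this, h4]
    simp
  have haj : (a * j) ^ 3 = 1 := by
    have : (a * j) ^ 3 = a⁻¹ * ((b⁻¹ * (a⁻¹ * (a ^ 2)⁻¹)) ^ 3)⁻¹ * a := by
      rw [hj']; simp [pow_succ, mul_assoc]
    rw [this, h5]
    simp
  refine ⟨ha, hj, haj, hx, ?_⟩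
  have hb : b = j * a * j := by
    rw [conj_eq_of_triangle hj haj, hj']
    group
  rw [hy, hb]
  calc (j * a * j) ^ 2 = j * a * (j * j) * a * j := by simp [pow_two, mul_assoc]
    _ = j * a ^ 2 * j := by rw [hj]; simp [pow_two, mul_assoc]

end Group

/-- The Coxeter matrix of the `(2,3,n)` triangle reflection group. -/
def triangleCoxeterMatrix (n : ℕ) (hn : n ≠ 1) : CoxeterMatrix (Fin 3) where
  M := !![1, 2, n; 2, 1, 3; n, 3, 1]
  isSymm := by
    ext i j
    fin_cases i <;> fin_cases j <;> rfl
  diagonal i := by fin_cases i <;> rfl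
  off_diagonal i j := by fin_cases i <;> fin_cases j <;> simp [hn]

theorem triangleCoxeterMatrix_isLiftable {H : Type*} [Group H] {n : ℕ} (hn : n ≠ 1) {s a j : H}
    (hs : s * s = 1) (hsa : s * a * s = a⁻¹) (hsj : s * j * s = j⁻¹) (ha : a ^ n = 1)
    (hj : j * j = 1) (haj : (a * j) ^ 3 = 1) :
    (triangleCoxeterMatrix n hn).IsLiftable ![s, s * j, a * s] := by
  have hsi : s⁻¹ = s := inv_eq_of_mul_eq_one_right hs
  have hja : (j * a) ^ 3 = 1 := by
    have : (j * a) ^ 3 = a⁻¹ * (a * j) ^ 3 * a := by simp [pow_succ, mul_assoc]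
    rw [this, haj]
    group
  intro i i'
  fin_cases i <;> fin_cases i'
  · change (s * s) ^ 1 = 1
    rw [pow_one, hs]
  · change (s * (s * j)) ^ 2 = 1
    rw [← mul_assoc, hs, one_mul, pow_two, hj]
  · change (s * (a * s)) ^ n = 1
    rw [← mul_assoc, hsa, inv_pow, ha, inv_one]
  · change (s * j * s) ^ 2 = 1
    rw [hsj, pow_two, ← _root_.mul_inv_rev, hj, inv_one]
  · change (s * j * (s * j)) ^ 1 = 1
    rw [pow_one, ← mul_assoc, hsj, inv_mul_cancel]
  · change (s * j * (a * s)) ^ 3 = 1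
    have : s * j * (a * s) = s * (j * a) * s⁻¹ := by rw [hsi]; group
    rw [this, conj_pow, hja]
    group
  · change (a * s * s) ^ n = 1
    rw [mul_assoc, hs, mul_one, ha]
  · change (a * s * (s * j)) ^ 3 = 1
    have : a * s * (s * j) = a * (s * s) * j := by group
    rw [this, hs, mul_one, haj]
  · change (a * s * (a * s)) ^ 1 = 1
    rw [pow_one, mul_assoc, ← mul_assoc s, hsa, mul_inv_cancel]

section Burau

variable {F : Type*} [Field F]

/-- The image of `g₁` under the reduced Burau representation. -/
noncomputable def burauA (q : F) (hq : q ≠ 0) : GL (Fin 2) F :=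
  Matrix.GeneralLinearGroup.mkOfDetNeZero !![q, 1; 0, 1] (by simpa [det_fin_two_of] using hq)

/-- The image of `g₁ g₂ g₁` under the reduced Burau representation. -/
noncomputable def burauJ (q : F) (hq : q ≠ 0) : GL (Fin 2) F :=
  Matrix.GeneralLinearGroup.mkOfDetNeZero !![0, q; -q ^ 2, 0] (by simpa [det_fin_two_of] using hq)

/-- The reduced Burau representation restricted to the free group on `g₁²` and `g₂²`. -/
noncomputable def burau (q : F) (hq : q ≠ 0) : FreeGroup (Fin 2) →* GL (Fin 2) F :=
  FreeGroup.lift ![burauA q hq ^ 2, burauJ q hq * burauA q hq ^ 2 * (burauJ q hq)⁻¹]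

theorem mem_center_iff_entries (g : GL (Fin 2) F) :
    g ∈ Subgroup.center (GL (Fin 2) F) ↔ g.val 0 1 = 0 ∧ g.val 1 0 = 0 ∧ g.val 0 0 = g.val 1 1 := by
  rw [Matrix.GeneralLinearGroup.mem_center_iff_val_mem_range_scalar]
  constructor
  · rintro ⟨c, hc⟩
    rw [← hc]
    simp
  · rintro ⟨h1, h2, h3⟩
    refine ⟨g.val 0 0, ?_⟩
    ext i j
    fin_cases i <;> fin_cases j <;> simp [h1, h2, h3]

theorem map_burau {K : Type*} [Field K] (g : K →+* F) (q : K) (hq : q ≠ 0) (hq' : g q ≠ 0)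
    (w : FreeGroup (Fin 2)) :
    Matrix.GeneralLinearGroup.map g (burau q hq w) = burau (g q) hq' w := by
  have hA : Matrix.GeneralLinearGroup.map g (burauA q hq) = burauA (g q) hq' := by
    ext i j
    fin_cases i <;> fin_cases j <;> simp [burauA, Matrix.GeneralLinearGroup.mkOfDetNeZero]
  have hJ : Matrix.GeneralLinearGroup.map g (burauJ q hq) = burauJ (g q) hq' := by
    ext i j
    fin_cases i <;> fin_cases j <;> simp [burauJ, Matrix.GeneralLinearGroup.mkOfDetNeZero]
  have : (Matrix.GeneralLinearGroup.map g).comp (burau q hq) = burau (g q) hq' := by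
    ext1 i
    fin_cases i <;> simp [burau, hA, hJ]
  rw [← this, MonoidHom.comp_apply]

theorem map_burau_mem_center_iff {K : Type*} [Field K] (g : K →+* F) (q : K) (hq : q ≠ 0)
    (hq' : g q ≠ 0) (w : FreeGroup (Fin 2)) :
    burau (g q) hq' w ∈ Subgroup.center (GL (Fin 2) F) ↔
      burau q hq w ∈ Subgroup.center (GL (Fin 2) K) := by
  rw [← map_burau g q hq hq' w, mem_center_iff_entries, mem_center_iff_entries]
  simp only [Matrix.GeneralLinearGroup.map_apply, map_eq_zero, g.injective.eq_iff]

/-- Whether a Burau matrix is scalar does not depend on the choice of the primitive root. -/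
theorem burau_mem_center_of_isPrimitiveRoot [CharZero F] {n : ℕ} (hn : n ≠ 0) {q r : F}
    (hq : IsPrimitiveRoot q n) (hr : IsPrimitiveRoot r n) (hq0 : q ≠ 0) (hr0 : r ≠ 0)
    {w : FreeGroup (Fin 2)} (hw : burau q hq0 w ∈ Subgroup.center (GL (Fin 2) F)) :
    burau r hr0 w ∈ Subgroup.center (GL (Fin 2) F) := by
  have : NeZero n := ⟨hn⟩
  have : IsCyclotomicExtension {n} ℚ (CyclotomicField n ℚ) :=
    CyclotomicField.isCyclotomicExtension n ℚ
  have hζ := IsCyclotomicExtension.zeta_spec n ℚ (CyclotomicField n ℚ)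
  have hirr := Polynomial.cyclotomic.irreducible_rat (Nat.pos_of_ne_zero hn)
  have hζ0 := hζ.ne_zero hn
  have hex : ∀ s : F, IsPrimitiveRoot s n →
      ∃ g : CyclotomicField n ℚ →+* F, g (IsCyclotomicExtension.zeta n ℚ _) = s := by
    intro s hs
    refine ⟨((hζ.embeddingsEquivPrimitiveRoots F hirr).symm
      ⟨s, (mem_primitiveRoots (Nat.pos_of_ne_zero hn)).2 hs⟩ : CyclotomicField n ℚ →ₐ[ℚ] F), ?_⟩
    have := hζ.embeddingsEquivPrimitiveRoots_apply_coe F hirr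
      ((hζ.embeddingsEquivPrimitiveRoots F hirr).symm
        ⟨s, (mem_primitiveRoots (Nat.pos_of_ne_zero hn)).2 hs⟩)
    rw [Equiv.apply_symm_apply] at this
    exact this.symm
  obtain ⟨g, rfl⟩ := hex q hq
  obtain ⟨g', rfl⟩ := hex r hr
  rw [map_burau_mem_center_iff g _ hζ0] at hw
  rwa [map_burau_mem_center_iff g' _ hζ0]

theorem burauA_pow {q : F} (hq : q ≠ 0) {n : ℕ} (hqn : q ^ n = 1) (hq1 : q ≠ 1) :
    burauA q hq ^ n = 1 := by
  have h : ∀ m : ℕ, (!![q, 1; 0, 1] : Matrix (Fin 2) (Fin 2) F) ^ m =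
      !![q ^ m, (q ^ m - 1) / (q - 1); 0, 1] := by
    intro m
    have : q - 1 ≠ 0 := sub_ne_zero.2 hq1
    induction m with
    | zero => ext i j; fin_cases i <;> fin_cases j <;> simp
    | succ m ih =>
      rw [pow_succ, ih]
      ext i j
      fin_cases i <;> fin_cases j <;> simp [Matrix.mul_apply, Fin.sum_univ_two]
      · ring
      · field_simp
        ring
  apply Units.ext
  rw [Units.val_pow_eq_pow_val]
  change (!![q, 1; 0, 1] : Matrix (Fin 2) (Fin 2) F) ^ n = 1
  rw [h, hqn]
  ext i j
  fin_cases i <;> fin_cases j <;> simp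

theorem burauJ_mul_self_mem_center {q : F} (hq : q ≠ 0) :
    burauJ q hq * burauJ q hq ∈ Subgroup.center (GL (Fin 2) F) := by
  rw [mem_center_iff_entries]
  simp [burauJ, Matrix.GeneralLinearGroup.mkOfDetNeZero, Matrix.mul_apply, Fin.sum_univ_two]
  ring

theorem burauA_mul_burauJ_pow_mem_center {q : F} (hq : q ≠ 0) :
    (burauA q hq * burauJ q hq) ^ 3 ∈ Subgroup.center (GL (Fin 2) F) := by
  rw [mem_center_iff_entries]
  simp [burauA, burauJ, Matrix.GeneralLinearGroup.mkOfDetNeZero, Matrix.mul_apply, pow_succ,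
    Fin.sum_univ_two]

end Burau

theorem AGL_eq {q : ℂ} (hq : q ≠ 0) : AGL q = burauA q hq ^ 2 := by
  rw [AGL, dif_neg hq, pow_two (burauA q hq)]
  ext i j
  fin_cases i <;> fin_cases j <;>
    simp [burauA, Matrix.GeneralLinearGroup.mkOfDetNeZero, Matrix.mul_apply, Fin.sum_univ_two]
  all_goals ring

theorem BGL_eq {q : ℂ} (hq : q ≠ 0) : BGL q = burauJ q hq * burauA q hq ^ 2 * (burauJ q hq)⁻¹ := by
  rw [BGL, dif_neg hq, eq_mul_inv_iff_mul_eq, pow_two (burauA q hq)]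
  ext i j
  fin_cases i <;> fin_cases j <;>
    simp [burauA, burauJ, Matrix.GeneralLinearGroup.mkOfDetNeZero, Matrix.mul_apply,
      Fin.sum_univ_two]
  all_goals first | exact Or.inl (by ring) | ring

theorem pgl_eq_one_iff (g : GL (Fin 2) ℂ) : pgl g = 1 ↔ g ∈ Subgroup.center (GL (Fin 2) ℂ) :=
  QuotientGroup.eq_one_iff g

section Roots

/-- Among the angles `π / n`, `n > 2`, only `π / 6` has cosine `√3 / 2`. -/
theorem cos_pi_div_nat_sq_ne (n : ℕ) (hn : 2 < n) (hn6 : n ≠ 6) :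
    0 < Real.cos (Real.pi / n) ∧ 2 * Real.cos (Real.pi / n) ^ 2 - 3 / 2 ≠ 0 := by
  set c : ℝ := Real.cos (Real.pi / n) with hc
  have hn0 : (2 : ℝ) < n := by exact_mod_cast hn
  have hle : Real.pi / n < Real.pi / 2 := div_lt_div_of_pos_left Real.pi_pos two_pos hn0
  have hpos : 0 < Real.pi / n := by positivity
  have hc0 : 0 < c := Real.cos_pos_of_mem_Ioo ⟨by linarith, hle⟩
  refine ⟨hc0, fun h ↦ ?_⟩
  have h1 : c = √3 / 2 := by
    have h3 : √3 ^ 2 = 3 := Real.sq_sqrt (by norm_num)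
    have : c ^ 2 = (√3 / 2) ^ 2 := by rw [div_pow, h3]; linarith
    exact (sq_eq_sq₀ hc0.le (by positivity)).1 this
  rw [← Real.cos_pi_div_six] at h1
  have h2 := Real.injOn_cos ⟨hpos.le, by linarith⟩
    ⟨by positivity, by linarith [Real.pi_pos]⟩ h1
  have h3 : (n : ℝ) = 6 := by
    field_simp at h2
    linarith
  exact hn6 (by exact_mod_cast h3)

/-- Square roots of `-1` in `M₂(ℂ)` representing the three reflections of the triangle group;
the parameters are intended to satisfy `ζ z = 1` and `μ² (z² + ζ² - 1) = -1`. -/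
noncomputable def triangleRoot (ζ z μ : ℂ) : Fin 3 → Matrix (Fin 2) (Fin 2) ℂ :=
  ![!![μ, μ * (z ^ 2 - 1); μ * (1 - ζ ^ 2), -μ],
    !![μ * (z - ζ), -(μ * z); -(μ * ζ), μ * (ζ - z)],
    !![-(μ * z), μ * ζ; μ * (ζ - z), μ * z]]

variable {ζ z μ : ℂ}

theorem triangleRoot_mul_self (hz : ζ * z = 1) (hμ : μ ^ 2 * (z ^ 2 + ζ ^ 2 - 1) = -1)
    (i : Fin 3) :
    triangleRoot ζ z μ i * triangleRoot ζ z μ i = -1 := by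
  fin_cases i <;> ext a b <;> fin_cases a <;> fin_cases b <;>
    simp [triangleRoot, Matrix.mul_apply, Fin.sum_univ_two] <;> grind

theorem triangleRoot_two_mul_zero (hz : ζ * z = 1) (hμ : μ ^ 2 * (z ^ 2 + ζ ^ 2 - 1) = -1) :
    triangleRoot ζ z μ 2 * triangleRoot ζ z μ 0 = !![ζ, z; 0, z] := by
  ext a b
  fin_cases a <;> fin_cases b <;>
    simp [triangleRoot, Matrix.mul_apply, Fin.sum_univ_two] <;> grind

theorem triangleRoot_zero_mul_one (hz : ζ * z = 1) (hμ : μ ^ 2 * (z ^ 2 + ζ ^ 2 - 1) = -1) :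
    triangleRoot ζ z μ 0 * triangleRoot ζ z μ 1 = !![0, z; -ζ, 0] := by
  ext a b
  fin_cases a <;> fin_cases b <;>
    simp [triangleRoot, Matrix.mul_apply, Fin.sum_univ_two] <;> grind

theorem triangleRoot_anticomm (hz : ζ * z = 1) (hμ : μ ^ 2 * (z ^ 2 + ζ ^ 2 - 1) = -1)
    (n : ℕ) (hn : n ≠ 1)
    (hcos : ζ + z = 2 * Complex.cos (Real.pi / n)) (i j : Fin 3) :
    triangleRoot ζ z μ i * triangleRoot ζ z μ j + triangleRoot ζ z μ j * triangleRoot ζ z μ i =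
      (2 * Real.cos (Real.pi / triangleCoxeterMatrix n hn i j)) •
        (1 : Matrix (Fin 2) (Fin 2) ℂ) := by
  have h01 : triangleRoot ζ z μ 0 * triangleRoot ζ z μ 1 +
      triangleRoot ζ z μ 1 * triangleRoot ζ z μ 0 = 0 := by
    ext a b
    fin_cases a <;> fin_cases b <;>
      simp [triangleRoot] <;> grind
  have h12 : triangleRoot ζ z μ 1 * triangleRoot ζ z μ 2 +
      triangleRoot ζ z μ 2 * triangleRoot ζ z μ 1 = 1 := by
    ext a b
    fin_cases a <;> fin_cases b <;>
      simp [triangleRoot] <;> grind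
  have h02 : triangleRoot ζ z μ 0 * triangleRoot ζ z μ 2 +
      triangleRoot ζ z μ 2 * triangleRoot ζ z μ 0 =
        (2 * Real.cos (Real.pi / n)) • (1 : Matrix (Fin 2) (Fin 2) ℂ) := by
    have : (2 * Real.cos (Real.pi / n)) • (1 : Matrix (Fin 2) (Fin 2) ℂ) =
        (ζ + z) • (1 : Matrix (Fin 2) (Fin 2) ℂ) := by
      rw [hcos]
      ext a b
      fin_cases a <;> fin_cases b <;> simp
    rw [this]
    ext a b
    fin_cases a <;> fin_cases b <;>
      simp [triangleRoot] <;> grind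
  have hself : ∀ i, triangleRoot ζ z μ i * triangleRoot ζ z μ i +
      triangleRoot ζ z μ i * triangleRoot ζ z μ i =
        (2 * Real.cos (Real.pi / (1 : ℕ))) • (1 : Matrix (Fin 2) (Fin 2) ℂ) := by
    intro i
    rw [triangleRoot_mul_self hz hμ, Nat.cast_one, div_one, Real.cos_pi]
    module
  have c2 : (2 * Real.cos (Real.pi / (2 : ℕ))) • (1 : Matrix (Fin 2) (Fin 2) ℂ) = 0 := by simp
  have c3 : (2 * Real.cos (Real.pi / (3 : ℕ))) • (1 : Matrix (Fin 2) (Fin 2) ℂ) = 1 := by simp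
  fin_cases i <;> fin_cases j
  · exact hself 0
  · exact h01.trans c2.symm
  · exact h02
  · exact ((add_comm _ _).trans h01).trans c2.symm
  · exact hself 1
  · exact h12.trans c3.symm
  · exact (add_comm _ _).trans h02
  · exact ((add_comm _ _).trans h12).trans c3.symm
  · exact hself 2

/-- The three roots lie in a common open half-space. -/
theorem exists_pos_triangleRoot (hz : ζ * z = 1) (hμ : μ ^ 2 * (z ^ 2 + ζ ^ 2 - 1) = -1)
    (n : ℕ) (hn : 2 < n) (hn6 : n ≠ 6)
    (hcos : ζ + z = 2 * Complex.cos (Real.pi / n)) :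
    ∃ f : Matrix (Fin 2) (Fin 2) ℂ →ₗ[ℝ] ℝ, ∀ i, 0 < f (triangleRoot ζ z μ i) := by
  have hn1 : n ≠ 1 := by omega
  set c : ℝ := Real.cos (Real.pi / n) with hc
  obtain ⟨hc0, hc3⟩ : 0 < c ∧ 2 * c ^ 2 - 3 / 2 ≠ 0 := cos_pi_div_nat_sq_ne n hn hn6
  have htr : ∀ i j, ((triangleRoot ζ z μ i * triangleRoot ζ z μ j).trace).re =
      2 * Real.cos (Real.pi / triangleCoxeterMatrix n hn1 i j) := by
    intro i j
    have h := congrArg (fun X ↦ X.trace.re) (triangleRoot_anticomm hz hμ n hn1 hcos i j)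
    simp only [trace_add, trace_mul_comm (triangleRoot ζ z μ j), trace_smul, trace_one,
      Fintype.card_fin, Complex.add_re] at h
    rw [Complex.smul_re, smul_eq_mul, Nat.cast_ofNat, Complex.re_ofNat] at h
    linarith
  set D : ℝ := 2 * c ^ 2 - 3 / 2 with hD
  set δ : ℝ := D / (2 * (2 * c + 1)) with hδ
  have hδ' : δ * (2 * c + 1) = D / 2 := by
    rw [hδ]
    field_simp
  let Y : Matrix (Fin 2) (Fin 2) ℂ := (D * (c - δ)) • triangleRoot ζ z μ 0 +
    (D * (1 / 2 - δ)) • triangleRoot ζ z μ 1 + D • triangleRoot ζ z μ 2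
  refine ⟨Complex.reLm ∘ₗ (traceLinearMap (Fin 2) ℝ ℂ) ∘ₗ LinearMap.mulLeft ℝ Y, fun i ↦ ?_⟩
  have hval : (Complex.reLm ∘ₗ (traceLinearMap (Fin 2) ℝ ℂ) ∘ₗ LinearMap.mulLeft ℝ Y)
      (triangleRoot ζ z μ i) =
      D * (c - δ) * (2 * Real.cos (Real.pi / triangleCoxeterMatrix n hn1 0 i)) +
      D * (1 / 2 - δ) * (2 * Real.cos (Real.pi / triangleCoxeterMatrix n hn1 1 i)) +
      D * (2 * Real.cos (Real.pi / triangleCoxeterMatrix n hn1 2 i)) := by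
    rw [← htr, ← htr, ← htr]
    simp only [LinearMap.comp_apply, LinearMap.mulLeft_apply, traceLinearMap_apply, Y, add_mul,
      smul_mul_assoc, trace_add, trace_smul]
    simp
  rw [hval]
  have hD2 : 0 < D ^ 2 := by positivity
  have hδD : 0 < δ * D := by
    rw [hδ, div_mul_eq_mul_div, ← pow_two]
    positivity
  have c1 : Real.cos (Real.pi / (1 : ℕ)) = -1 := by simp
  have c2 : Real.cos (Real.pi / (2 : ℕ)) = 0 := by simp
  have c3 : Real.cos (Real.pi / (3 : ℕ)) = 1 / 2 := by simp
  fin_cases i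
  · change 0 < D * (c - δ) * (2 * Real.cos (Real.pi / (1 : ℕ))) +
      D * (1 / 2 - δ) * (2 * Real.cos (Real.pi / (2 : ℕ))) + D * (2 * c)
    rw [c1, c2]
    linarith
  · change 0 < D * (c - δ) * (2 * Real.cos (Real.pi / (2 : ℕ))) +
      D * (1 / 2 - δ) * (2 * Real.cos (Real.pi / (1 : ℕ))) +
      D * (2 * Real.cos (Real.pi / (3 : ℕ)))
    rw [c1, c2, c3]
    linarith
  · change 0 < D * (c - δ) * (2 * c) +
      D * (1 / 2 - δ) * (2 * Real.cos (Real.pi / (3 : ℕ))) +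
      D * (2 * Real.cos (Real.pi / (1 : ℕ)))
    rw [c1, c3]
    have : D * (c - δ) * (2 * c) + D * (1 / 2 - δ) * (2 * (1 / 2)) + D * (2 * -1) =
      D * (D - δ * (2 * c + 1)) := by rw [hD]; ring
    rw [this, hδ']
    linarith

end Roots

section Conjugation

/-- The action of `GL₂(ℂ)` on `M₂(ℂ)` by conjugation. -/
noncomputable def conjEnd : GL (Fin 2) ℂ →* Module.End ℝ (Matrix (Fin 2) (Fin 2) ℂ) where
  toFun g := LinearMap.mulLeft ℝ g.val * LinearMap.mulRight ℝ g⁻¹.val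
  map_one' := by
    ext1 X
    simp
  map_mul' g h := by
    ext1 X
    simp [_root_.mul_inv_rev, mul_assoc]

theorem conjEnd_apply (g : GL (Fin 2) ℂ) (X : Matrix (Fin 2) (Fin 2) ℂ) :
    conjEnd g X = g.val * X * g⁻¹.val :=
  (mul_assoc _ _ _).symm

theorem conjEnd_apply_of_val_eq_smul {g : GL (Fin 2) ℂ} {t : ℂ} (ht : t ≠ 0)
    {x y : Matrix (Fin 2) (Fin 2) ℂ} (hg : g.val = t • x) (hxy : x * y = 1)
    (X : Matrix (Fin 2) (Fin 2) ℂ) : conjEnd g X = x * X * y := by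
  have hg' : g⁻¹.val = t⁻¹ • y := by
    rw [Units.inv_eq_of_mul_eq_one_right]
    rw [hg, smul_mul_smul_comm, mul_inv_cancel₀ ht, hxy, one_smul]
  rw [conjEnd_apply, hg, hg', smul_mul_assoc, smul_mul_smul_comm, mul_inv_cancel₀ ht, one_smul]

theorem conjEnd_eq_one_of_mem_center {g : GL (Fin 2) ℂ}
    (hg : g ∈ Subgroup.center (GL (Fin 2) ℂ)) : conjEnd g = 1 := by
  obtain ⟨c, hc⟩ := Matrix.GeneralLinearGroup.mem_center_iff_val_mem_range_scalar.1 hg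
  ext1 X
  rw [conjEnd_apply, ← hc, (Matrix.scalar_commute c (Commute.all c) X).eq, hc, mul_assoc,
    ← Units.val_mul, mul_inv_cancel, Units.val_one, mul_one, Module.End.one_apply]

end Conjugation

section Presentation

variable {k : ℕ}

/-- The relators of `burauRels` die in `PGL(2,ℂ)`. -/
theorem pgl_burau_eq_one_of_mem_burauRels (hk : k ≠ 0) {q : ℂ}
    (hq : IsPrimitiveRoot q (2 * k + 1)) (hq0 : q ≠ 0) {r : FreeGroup (Fin 2)}
    (hr : r ∈ burauRels k) : pgl (burau q hq0 r) = 1 := by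
  have hj : pgl (burauJ q hq0) * pgl (burauJ q hq0) = 1 := by
    rw [← map_mul, pgl_eq_one_iff]
    exact burauJ_mul_self_mem_center hq0
  refine burauRels_of_triangle hk (a := pgl (burauA q hq0)) (j := pgl (burauJ q hq0)) ?_ hj ?_
    (pgl.comp (burau q hq0)) ?_ ?_ r hr
  · rw [← map_pow, burauA_pow hq0 hq.pow_eq_one (hq.ne_one (by omega)), map_one]
  · rw [← map_mul, ← map_pow, pgl_eq_one_iff]
    exact burauA_mul_burauJ_pow_mem_center hq0
  · simp [burau]
  · simp [burau, inv_eq_of_mul_eq_one_right hj]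

/-- The homomorphism from the free group to the triangle reflection group with
`x ↦ (us)²` and `y ↦ (st)(us)²(st)`, where `s, t, u` are the simple reflections. -/
noncomputable def toTriangleCoxeter (n : ℕ) (hn : n ≠ 1) :
    FreeGroup (Fin 2) →* (triangleCoxeterMatrix n hn).Group :=
  let cs := (triangleCoxeterMatrix n hn).toCoxeterSystem
  FreeGroup.lift ![(cs.simple 2 * cs.simple 0) ^ 2, cs.simple 0 * cs.simple 1 *
    (cs.simple 2 * cs.simple 0) ^ 2 * (cs.simple 0 * cs.simple 1)]

/-- The kernel of `toTriangleCoxeter` is contained in the normal closure of `burauRels`. -/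
theorem mem_normalClosure_of_toTriangleCoxeter_eq_one (hk : k ≠ 0) {w : FreeGroup (Fin 2)}
    (hn1 : 2 * k + 1 ≠ 1) (hw : toTriangleCoxeter (2 * k + 1) hn1 w = 1) :
    w ∈ Subgroup.normalClosure (burauRels k) := by
  let p : FreeGroup (Fin 2) →* PresentedGroup (burauRels k) := PresentedGroup.mk _
  have hp : ∀ r ∈ burauRels k, p r = 1 := fun r hr ↦ PresentedGroup.one_of_mem hr
  obtain ⟨x, hx⟩ : ∃ x, p (.of 0) = x := ⟨_, rfl⟩
  obtain ⟨y, hy⟩ : ∃ y, p (.of 1) = y := ⟨_, rfl⟩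
  obtain ⟨a, hxa⟩ : ∃ a, a = x ^ (k + 1) := ⟨_, rfl⟩
  obtain ⟨b, hyb⟩ : ∃ b, b = y ^ (k + 1) := ⟨_, rfl⟩
  obtain ⟨j, hj'⟩ : ∃ j, j = a * b * a := ⟨_, rfl⟩
  obtain ⟨ha, hj, haj, hxa2, hya2⟩ := triangle_of_burauRels hk p hx hy hp hxa hyb hj'
  have hji : j⁻¹ = j := inv_eq_of_mul_eq_one_right hj
  have haj' : (a⁻¹ * j) ^ 3 = 1 := by
    have : (a⁻¹ * j) ^ 3 = a⁻¹ * ((a * j) ^ 3)⁻¹ * a := by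
      simp [pow_succ, mul_assoc, hji]
    rw [this, haj]
    simp
  have hinv : ∀ r ∈ burauRels k, FreeGroup.lift ![x⁻¹, y⁻¹] r = 1 := by
    refine burauRels_of_triangle hk (a := a⁻¹) (j := j) (by rw [inv_pow, ha, inv_one]) hj haj' _ ?_ ?_
    · simp [hxa2]
    · simp [hya2, hji, mul_assoc]
  let σ : PresentedGroup (burauRels k) →* PresentedGroup (burauRels k) :=
    PresentedGroup.toGroup hinv
  have hσx : σ x = x⁻¹ := by
    rw [← hx]
    exact (PresentedGroup.toGroup.of hinv).trans (by simp [← hx])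
  have hσy : σ y = y⁻¹ := by
    rw [← hy]
    exact (PresentedGroup.toGroup.of hinv).trans (by simp [← hy])
  have hσσ : σ.comp σ = MonoidHom.id _ := by
    apply PresentedGroup.ext
    intro i
    fin_cases i
    · change σ (σ (p (.of 0))) = p (.of 0)
      rw [hx, hσx, map_inv, hσx, inv_inv]
    · change σ (σ (p (.of 1))) = p (.of 1)
      rw [hy, hσy, map_inv, hσy, inv_inv]
  have hσa : σ a = a⁻¹ := by rw [hxa, map_pow, hσx, inv_pow]
  have hσb : σ b = b⁻¹ := by rw [hyb, map_pow, hσy, inv_pow]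
  have hσj : σ j = j⁻¹ := by
    rw [hj', map_mul, map_mul, hσa, hσb]
    group
  let L : PresentedGroup (burauRels k) →* Equiv.Perm (PresentedGroup (burauRels k)) :=
    MulAction.toPermHom _ _
  have hL : ∀ g h, L g h = g * h := fun _ _ ↦ rfl
  let s : Equiv.Perm (PresentedGroup (burauRels k)) := (MonoidHom.toMulEquiv σ σ hσσ hσσ).toEquiv
  have hsapp : ∀ g, s g = σ g := fun _ ↦ rfl
  have hs : s * s = 1 := by
    ext g
    exact DFunLike.congr_fun hσσ g
  have hsL : ∀ g, s * L g * s = L (σ g) := by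
    intro g
    ext h
    simp only [Equiv.Perm.mul_apply, hsapp, hL, map_mul]
    congr 1
    exact DFunLike.congr_fun hσσ h
  have hlift := triangleCoxeterMatrix_isLiftable (n := 2 * k + 1) hn1 (s := s) (a := L a)
    (j := L j) hs (by rw [hsL, hσa, map_inv]) (by rw [hsL, hσj, map_inv])
    (by rw [← map_pow, ha, map_one]) (by rw [← map_mul, hj, map_one])
    (by rw [← map_mul, ← map_pow, haj, map_one])
  let cs := (triangleCoxeterMatrix (2 * k + 1) hn1).toCoxeterSystem
  let Φ := cs.lift ⟨_, hlift⟩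
  have hΦ0 : Φ (cs.simple 0) = s := cs.lift_apply_simple hlift 0
  have hΦ1 : Φ (cs.simple 1) = s * L j := cs.lift_apply_simple hlift 1
  have hΦ2 : Φ (cs.simple 2) = L a * s := cs.lift_apply_simple hlift 2
  have hΦ20 : Φ (cs.simple 2 * cs.simple 0) = L a := by
    rw [map_mul, hΦ0, hΦ2, mul_assoc, hs, mul_one]
  have hΦ01 : Φ (cs.simple 0 * cs.simple 1) = L j := by
    rw [map_mul, hΦ0, hΦ1, ← mul_assoc, hs, one_mul]
  have hcomp : Φ.comp (toTriangleCoxeter (2 * k + 1) hn1) = L.comp p := by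
    ext1 i
    fin_cases i
    · change Φ (FreeGroup.lift _ (.of 0)) = L (p (.of 0))
      rw [FreeGroup.lift_apply_of, hx, hxa2, map_pow, ← hΦ20, ← map_pow]
      rfl
    · change Φ (FreeGroup.lift _ (.of 1)) = L (p (.of 1))
      rw [FreeGroup.lift_apply_of, hy, hya2, map_mul, map_mul, map_pow, ← hΦ20, ← hΦ01, ← map_pow,
        ← map_mul, ← map_mul]
      rfl
  have h1 : L (p w) = 1 := by
    rw [← MonoidHom.comp_apply, ← hcomp, MonoidHom.comp_apply, hw, map_one]
  have h2 : p w = 1 := by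
    have := congrArg (fun e ↦ e 1) h1
    simpa [hL] using this
  exact (QuotientGroup.eq_one_iff w).1 h2

/-- At `q = exp(2πi/n)`, the Burau representation factors through the geometric representation
of the triangle reflection group, which is faithful. -/
theorem toTriangleCoxeter_eq_one_of_mem_center {n : ℕ} (hn : 2 < n) (hn6 : n ≠ 6) (hn1 : n ≠ 1)
    {q : ℂ} (hq0 : q ≠ 0) (hqe : q = Complex.exp (2 * Real.pi * Complex.I / n))
    {w : FreeGroup (Fin 2)} (hw : burau q hq0 w ∈ Subgroup.center (GL (Fin 2) ℂ)) :
    toTriangleCoxeter n hn1 w = 1 := by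
  obtain ⟨ζ, hζ⟩ : ∃ ζ, ζ = Complex.exp (Real.pi / n * Complex.I) := ⟨_, rfl⟩
  obtain ⟨z, hz'⟩ : ∃ z, z = Complex.exp (-(Real.pi / n * Complex.I)) := ⟨_, rfl⟩
  have hz : ζ * z = 1 := by rw [hζ, hz', ← Complex.exp_add, add_neg_cancel, Complex.exp_zero]
  have hqζ : q = ζ ^ 2 := by
    rw [hqe, hζ, ← Complex.exp_nat_mul]
    congr 1
    push_cast
    ring
  have hcos : ζ + z = 2 * Complex.cos (Real.pi / n) := by
    rw [Complex.two_cos, hζ, hz', neg_mul]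
  have hne : z ^ 2 + ζ ^ 2 - 1 ≠ 0 := by
    have h1 : z ^ 2 + ζ ^ 2 - 1 = 2 * (2 * Complex.cos (Real.pi / n) ^ 2 - 3 / 2) := by
      linear_combination (ζ + z + 2 * Complex.cos (Real.pi / n)) * hcos - 2 * hz
    have h2 := (cos_pi_div_nat_sq_ne n hn hn6).2
    rw [h1]
    exact mul_ne_zero two_ne_zero fun h ↦ h2 (Complex.ofReal_injective (by push_cast; exact h))
  obtain ⟨μ, hμ'⟩ := IsAlgClosed.exists_pow_nat_eq (-(z ^ 2 + ζ ^ 2 - 1)⁻¹) two_pos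
  have hμ : μ ^ 2 * (z ^ 2 + ζ ^ 2 - 1) = -1 := by
    rw [hμ', neg_mul, inv_mul_cancel₀ hne]
  have hM : ∀ i j, triangleCoxeterMatrix n hn1 i j ≠ 0 := by
    intro i j
    fin_cases i <;> fin_cases j <;> simp [triangleCoxeterMatrix] <;> omega
  have hE := triangleRoot_mul_self hz hμ
  have hEE := triangleRoot_anticomm hz hμ n hn1 hcos
  have hlift := CoxeterMatrix.isLiftable_sandwich hM hE hEE
  let cs := (triangleCoxeterMatrix n hn1).toCoxeterSystem
  let ρ := cs.lift ⟨_, hlift⟩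
  have hρ : ∀ i, ρ (cs.simple i) = sandwich (triangleRoot ζ z μ i) :=
    fun i ↦ cs.lift_apply_simple hlift i
  obtain ⟨f, hf⟩ := exists_pos_triangleRoot hz hμ n hn hn6 hcos
  have hinj : Function.Injective ρ := cs.geometric_injective (e := triangleRoot ζ z μ) hM
    (fun i j ↦ by rw [hρ]; exact CoxeterMatrix.sandwich_apply_root hE hEE i j) f hf
  have hs2 := triangleRoot_two_mul_zero hz hμ
  have hs1 := triangleRoot_zero_mul_one hz hμ
  have hinv : ∀ i j, triangleRoot ζ z μ i * triangleRoot ζ z μ j *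
      (triangleRoot ζ z μ j * triangleRoot ζ z μ i) = 1 := by
    intro i j
    rw [mul_assoc, ← mul_assoc (triangleRoot ζ z μ j), hE, neg_one_mul, mul_neg, hE, neg_neg]
  have hρρ : ∀ i j X, ρ (cs.simple i * cs.simple j) X =
      triangleRoot ζ z μ i * triangleRoot ζ z μ j * X *
        (triangleRoot ζ z μ j * triangleRoot ζ z μ i) := by
    intro i j X
    rw [map_mul, hρ, hρ]
    simp only [Module.End.mul_apply, sandwich_apply, mul_assoc]
  have hζ0 : ζ ≠ 0 := left_ne_zero_of_mul_eq_one hz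
  have hA : conjEnd (burauA q hq0) = ρ (cs.simple 2 * cs.simple 0) := by
    ext1 X
    rw [hρρ]
    refine conjEnd_apply_of_val_eq_smul hζ0 ?_ (hinv 2 0) X
    rw [hs2]
    ext a b
    fin_cases a <;> fin_cases b <;> simp [burauA, Matrix.GeneralLinearGroup.mkOfDetNeZero, hqζ]
    all_goals grind
  have hJ : conjEnd (burauJ q hq0) = ρ (cs.simple 0 * cs.simple 1) := by
    ext1 X
    rw [hρρ]
    refine conjEnd_apply_of_val_eq_smul (pow_ne_zero 3 hζ0) ?_ (hinv 0 1) X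
    rw [hs1]
    ext a b
    fin_cases a <;> fin_cases b <;> simp [burauJ, Matrix.GeneralLinearGroup.mkOfDetNeZero, hqζ]
    all_goals grind
  have h01 : cs.simple 0 * cs.simple 1 * (cs.simple 0 * cs.simple 1) = 1 := by
    rw [← pow_two]
    exact cs.simple_mul_simple_pow 0 1
  have hJ' : conjEnd (burauJ q hq0)⁻¹ = ρ (cs.simple 0 * cs.simple 1) := by
    have h1 : conjEnd (burauJ q hq0) * conjEnd (burauJ q hq0) = 1 := by
      rw [hJ, ← map_mul, h01, map_one]
    rw [← hJ]
    calc conjEnd (burauJ q hq0)⁻¹ = conjEnd (burauJ q hq0)⁻¹ * (conjEnd (burauJ q hq0) *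
          conjEnd (burauJ q hq0)) := by rw [h1, mul_one]
      _ = conjEnd (burauJ q hq0) := by
        rw [← mul_assoc, ← map_mul, inv_mul_cancel, map_one, one_mul]
  have hcomp : ρ.comp (toTriangleCoxeter n hn1) = conjEnd.comp (burau q hq0) := by
    ext1 i
    fin_cases i
    · change ρ (FreeGroup.lift _ (.of 0)) = conjEnd (FreeGroup.lift _ (.of 0))
      rw [FreeGroup.lift_apply_of, FreeGroup.lift_apply_of]
      change ρ ((cs.simple 2 * cs.simple 0) ^ 2) = conjEnd (burauA q hq0 ^ 2)
      rw [map_pow, map_pow, hA]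
    · change ρ (FreeGroup.lift _ (.of 1)) = conjEnd (FreeGroup.lift _ (.of 1))
      rw [FreeGroup.lift_apply_of, FreeGroup.lift_apply_of]
      change ρ (cs.simple 0 * cs.simple 1 * (cs.simple 2 * cs.simple 0) ^ 2 *
        (cs.simple 0 * cs.simple 1)) =
          conjEnd (burauJ q hq0 * burauA q hq0 ^ 2 * (burauJ q hq0)⁻¹)
      rw [map_mul conjEnd, map_mul conjEnd, map_pow conjEnd, hA, hJ, hJ']
      simp only [map_mul, map_pow]
  apply hinj
  rw [map_one, ← conjEnd_eq_one_of_mem_center hw]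
  exact DFunLike.congr_fun hcomp w

end Presentation

/-- Let `n = 2k+1` be odd, `n ≠ 1`, and let `q` be a primitive `n`-th root of
unity. If `φ : F₂ → PGL(2,ℂ)` is the homomorphism from the free group on two generators
`x, y` with `φ(x) = [A(q)]` and `φ(y) = [B(q)]`, then `ker φ` is the normal closure of
`{x^(2k+1), y^(2k+1), (xy)^(2k+1), (x⁻¹y^k)², (y^k x^(k−1))³}` in `F₂`. -/
theorem stmt6 (n k : ℕ) (hn : n = 2 * k + 1) (hn1 : n ≠ 1)
    (q : ℂ) (hq : IsPrimitiveRoot q n)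
    (φ : FreeGroup (Fin 2) →* PGL2)
    (hφ0 : φ (FreeGroup.of 0) = Apr q) (hφ1 : φ (FreeGroup.of 1) = Bpr q) :
    φ.ker = Subgroup.normalClosure
      {(FreeGroup.of 0) ^ (2 * k + 1), (FreeGroup.of 1) ^ (2 * k + 1),
       (FreeGroup.of 0 * FreeGroup.of 1) ^ (2 * k + 1),
       ((FreeGroup.of 0)⁻¹ * (FreeGroup.of 1) ^ k) ^ 2,
       ((FreeGroup.of 1) ^ k * (FreeGroup.of 0) ^ (k - 1)) ^ 3} := by
  obtain rfl := hn
  have hk : k ≠ 0 := by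
    rintro rfl
    exact hn1 rfl
  have hq0 : q ≠ 0 := hq.ne_zero (by omega)
  have hφ : φ = pgl.comp (burau q hq0) := by
    ext1 i
    fin_cases i
    · change φ (FreeGroup.of 0) = _
      rw [hφ0, Apr, AGL_eq hq0]
      simp [burau]
    · change φ (FreeGroup.of 1) = _
      rw [hφ1, Bpr, BGL_eq hq0]
      simp [burau]
  change φ.ker = Subgroup.normalClosure (burauRels k)
  apply le_antisymm
  · intro w hw
    rw [MonoidHom.mem_ker, hφ, MonoidHom.comp_apply, pgl_eq_one_iff] at hw
    have hw' := burau_mem_center_of_isPrimitiveRoot (by omega) hq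
      (Complex.isPrimitiveRoot_exp (2 * k + 1) (by omega)) hq0 (Complex.exp_ne_zero _) hw
    exact mem_normalClosure_of_toTriangleCoxeter_eq_one hk hn1
      (toTriangleCoxeter_eq_one_of_mem_center (by omega) (by omega) hn1 _ rfl hw')
  · refine Subgroup.normalClosure_le_normal fun r hr ↦ ?_
    rw [SetLike.mem_coe, MonoidHom.mem_ker, hφ]
    exact pgl_burau_eq_one_of_mem_burauRels hk hq hq0 hr
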